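/- The map Φ is continuous and 2π-periodic (in particular Φ(0) = Φ(2π)), Φ is injective on the half-open interval [0, 2π), and if λ > μ then Φ is real-analytic on ℝ; consequently the image Φ([0, 2π]) is a simple closed curve in Π. -/

import Mathlib

noncomputable section

open Real Set

/-- Membership predicate for conformally inscribed parallelograms.
Coordinates of `P : Fin 9 → ℝ`:
`0 = x_A, 1 = y_A, 2 = x_B, 3 = y_B, 4 = x_C, 5 = y_C, 6 = x_D, 7 = y_D, 8 = w`.
The vertex `(x_L, y_L)` lies on the line `L(w)` for `L ∈ {A,B,C,D}` and the
midpoints of the two diagonals coincide. -/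
def IsCIP (mA mB mC mD bA : ℝ) (P : Fin 9 → ℝ) : Prop :=
  P 1 = mA * P 0 + bA * P 8 ∧
  P 3 = mB * P 2 + P 8 ∧
  P 5 = mC * P 4 ∧
  P 7 = mD * P 6 ∧
  P 0 + P 4 = P 2 + P 6 ∧
  P 1 + P 5 = P 3 + P 7

/-- `Π`, the set of conformally inscribed parallelograms. -/
def CIP (mA mB mC mD bA : ℝ) : Set (Fin 9 → ℝ) := {P | IsCIP mA mB mC mD bA P}

/-- The `AC` diagonal vector of a parallelogram. -/
def vAC (P : Fin 9 → ℝ) : ℝ × ℝ := (P 0 - P 4, P 1 - P 5)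

/-- The `BD` diagonal vector of a parallelogram. -/
def vBD (P : Fin 9 → ℝ) : ℝ × ℝ := (P 2 - P 6, P 3 - P 7)

/-- The `AB` side vector of a parallelogram. -/
def vAB (P : Fin 9 → ℝ) : ℝ × ℝ := (P 0 - P 2, P 1 - P 3)

/-- The `BC` side vector of a parallelogram. -/
def vBC (P : Fin 9 → ℝ) : ℝ × ℝ := (P 2 - P 4, P 3 - P 5)

/-- Dot product in `ℝ²`. -/
def dot2 (a b : ℝ × ℝ) : ℝ := a.1 * b.1 + a.2 * b.2

/-- The inner product `⟨P, Q⟩ = P_AC · Q_AC + P_BD · Q_BD` on `Π`. -/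
def pinner (P Q : Fin 9 → ℝ) : ℝ := dot2 (vAC P) (vAC Q) + dot2 (vBD P) (vBD Q)

/-- The parametrization `Φ` of a conformal solution. -/
def Phi (U V T : Fin 9 → ℝ) (lam mu : ℝ) (θ : ℝ) : Fin 9 → ℝ :=
  (Real.sqrt (lam - mu * Real.cos θ ^ 2) / Real.sqrt (2 * lam)) • U +
    (Real.sin θ / Real.sqrt 2) • V + (Real.cos θ / Real.sqrt (2 * lam)) • T

lemma pinner_comm (P Q : Fin 9 → ℝ) : pinner P Q = pinner Q P := by
  simp only [pinner, dot2]
  ring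

lemma pinner_linearCombination (a b c : ℝ) (U V T W : Fin 9 → ℝ) :
    pinner (a • U + b • V + c • T) W =
      a * pinner U W + b * pinner V W + c * pinner T W := by
  simp only [pinner, dot2, vAC, vBD, Pi.add_apply, Pi.smul_apply, smul_eq_mul]
  ring

lemma continuous_Phi (U V T : Fin 9 → ℝ) (lam mu : ℝ) : Continuous (Phi U V T lam mu) := by
  unfold Phi
  fun_prop

lemma periodic_Phi (U V T : Fin 9 → ℝ) (lam mu : ℝ) :
    Function.Periodic (Phi U V T lam mu) (2 * π) := fun θ ↦ by
  simp only [Phi, Real.cos_add_two_pi, Real.sin_add_two_pi]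

/-- If `V` and `T` belong to an orthonormal system, `Φ` separates angles modulo `2π`. -/
lemma coe_angle_eq_of_Phi_eq {U V T : Fin 9 → ℝ} {lam mu : ℝ} (hlam : 0 < lam)
    (hVV : pinner V V = 1) (hTT : pinner T T = 1)
    (hUV : pinner U V = 0) (hUT : pinner U T = 0) (hVT : pinner V T = 0) {x y : ℝ}
    (h : Phi U V T lam mu x = Phi U V T lam mu y) : (x : Real.Angle) = y := by
  have hTV : pinner T V = 0 := by rw [pinner_comm, hVT]
  have hsin := congrArg (pinner · V) h
  have hcos := congrArg (pinner · T) h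
  simp only [Phi, pinner_linearCombination, hVV, hTT, hUV, hUT, hVT, hTV, mul_zero, mul_one,
    zero_add, add_zero] at hsin hcos
  have h2 : √(2 : ℝ) ≠ 0 := by positivity
  have h2lam : √(2 * lam) ≠ 0 := by positivity
  exact Real.Angle.cos_sin_inj ((div_left_inj' h2lam).1 hcos) ((div_left_inj' h2).1 hsin)

lemma analyticAt_Phi (U V T : Fin 9 → ℝ) {lam mu : ℝ} (hmu : 0 ≤ mu) (h : mu < lam) (θ : ℝ) :
    AnalyticAt ℝ (Phi U V T lam mu) θ := by
  have hpos : 0 < lam - mu * Real.cos θ ^ 2 := by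
    nlinarith [Real.cos_sq_le_one θ]
  have hcos : AnalyticAt ℝ Real.cos θ := Real.analyticAt_cos
  have hsin : AnalyticAt ℝ Real.sin θ := Real.analyticAt_sin
  have hsqrt : AnalyticAt ℝ (fun x ↦ √(lam - mu * Real.cos x ^ 2)) θ :=
    (Real.contDiffAt_sqrt (n := ⊤) hpos.ne').analyticAt.comp_of_eq
      (analyticAt_const.sub (analyticAt_const.mul (hcos.pow 2))) rfl
  exact (((hsqrt.div_const).smul analyticAt_const).add
    ((hsin.div_const).smul analyticAt_const)).add ((hcos.div_const).smul analyticAt_const)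

theorem stmt_11 (mA mB mC mD bA : ℝ) (hCD : mC ≠ mD)
    (U V T : Fin 9 → ℝ)
    (hU : U ∈ CIP mA mB mC mD bA) (hV : V ∈ CIP mA mB mC mD bA)
    (hT : T ∈ CIP mA mB mC mD bA)
    (hUU : pinner U U = 1) (hVV : pinner V V = 1) (hTT : pinner T T = 1)
    (hUV : pinner U V = 0) (hUT : pinner U T = 0) (hVT : pinner V T = 0)
    (hspan : ∀ P ∈ CIP mA mB mC mD bA, ∃ u v t : ℝ, P = u • U + v • V + t • T)
    (hUAC : vAC U = (0, 0)) (hVBD : vBD V = (0, 0))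
    (lam mu : ℝ) (hlam : lam = dot2 (vAC T) (vAC T)) (hmu : mu = dot2 (vBD T) (vBD T))
    (hge : mu ≤ lam) :
    Continuous (Phi U V T lam mu) ∧
    (∀ θ : ℝ, Phi U V T lam mu (θ + 2 * π) = Phi U V T lam mu θ) ∧
    Phi U V T lam mu 0 = Phi U V T lam mu (2 * π) ∧
    Set.InjOn (Phi U V T lam mu) (Set.Ico 0 (2 * π)) ∧
    (mu < lam → ∀ θ : ℝ, AnalyticAt ℝ (Phi U V T lam mu) θ) ∧
    (∃ f : AddCircle (2 * π) → (Fin 9 → ℝ), Continuous f ∧ Function.Injective f ∧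
        Set.range f = Phi U V T lam mu '' Set.Icc 0 (2 * π)) := by
  have hmu0 : 0 ≤ mu := by
    rw [hmu, dot2]
    nlinarith [sq_nonneg (vBD T).1, sq_nonneg (vBD T).2]
  have hlam0 : 0 < lam := by
    rw [pinner, ← hlam, ← hmu] at hTT
    linarith
  have hper := periodic_Phi U V T lam mu
  have hinj {x y : ℝ} (h : Phi U V T lam mu x = Phi U V T lam mu y) :
      (x : AddCircle (2 * π)) = y :=
    coe_angle_eq_of_Phi_eq hlam0 hVV hTT hUV hUT hVT h
  have : Fact (0 < 2 * π) := ⟨Real.two_pi_pos⟩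
  refine ⟨continuous_Phi U V T lam mu, hper, by simpa using (hper 0).symm, ?_,
    fun h θ ↦ analyticAt_Phi U V T hmu0 h θ, hper.lift, ?_, ?_, ?_⟩
  · intro x hx y hy h
    exact (AddCircle.coe_eq_coe_iff_of_mem_Ico (a := 0) (by simpa using hx)
      (by simpa using hy)).1 (hinj h)
  · exact continuous_coinduced_dom.2 (continuous_Phi U V T lam mu)
  · intro x y
    induction x using QuotientAddGroup.induction_on
    induction y using QuotientAddGroup.induction_on
    exact hinj
  · have himage := hper.image_Icc Real.two_pi_pos 0
    rw [zero_add] at himage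
    rw [himage]
    exact (QuotientAddGroup.mk_surjective.range_comp hper.lift).symm
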